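/- arXiv:0802.1804 — 4 statements merged into one kernel-verified Lean document; each statement's English description precedes it below -/
import Mathlib

section
/- Let N ≥ 3 and let Ω ⊆ ℝ^N be a bounded open nonempty set. For 0 < μ ≤ μ*, let λ₁(μ) be the infimum, over all test functions φ on Ω that are not identically zero, of the Rayleigh quotient ( ∫_Ω ‖∇φ‖² dx − μ ∫_Ω φ²/‖x‖² dx ) / ∫_Ω φ² dx. Then: (i) λ₁ is antitone on (0, μ*] (if μ₁ < μ₂ then λ₁(μ₂) ≤ λ₁(μ₁)); (ii) λ₁(μ*) > 0; and (iii) there exists λ_* ≥ λ₁(μ*) > 0 such that λ₁(μ) decreases to λ_* as μ increases to μ* (i.e. λ₁(μ) tends to λ_* as μ → μ* from the left). -/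
open MeasureTheory

/-- The principal eigenvalue `λ₁(μ)` of `-Δ - μ/|x|²` on `Ω`, defined as the infimum of the
Rayleigh quotient over nonzero test functions on `Ω`. -/
noncomputable def principalEigenvalue (N : ℕ) (Ω : Set (EuclideanSpace ℝ (Fin N))) (μ : ℝ) : ℝ :=
  sInf { t : ℝ | ∃ φ : EuclideanSpace ℝ (Fin N) → ℝ,
    ContDiff ℝ (⊤ : ℕ∞) φ ∧ HasCompactSupport φ ∧ tsupport φ ⊆ Ω ∧ φ ≠ 0 ∧
    t = ((∫ x in Ω, ‖gradient φ x‖ ^ 2) - μ * ∫ x in Ω, (φ x) ^ 2 / ‖x‖ ^ 2) /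
          ∫ x in Ω, (φ x) ^ 2 }

/-- Divergence theorem for the radial vector field `k x • x` against a compactly supported `w`. -/
lemma parts_radial (N : ℕ) (w k : EuclideanSpace ℝ (Fin N) → ℝ) (hw : ContDiff ℝ 1 w)
    (hwc : HasCompactSupport w) (hk : ContDiff ℝ 1 k) :
    ∫ x, w x * (N * k x + fderiv ℝ k x x) = - ∫ x, fderiv ℝ w x x * k x := by
  have hwd : Differentiable ℝ w := hw.differentiable (by norm_num)
  have hkd : Differentiable ℝ k := hk.differentiable (by norm_num)
  have hwf : Continuous (fderiv ℝ w) := hw.continuous_fderiv (by norm_num)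
  have hkf : Continuous (fderiv ℝ k) := hk.continuous_fderiv (by norm_num)
  have hsum : ∀ x : EuclideanSpace ℝ (Fin N), ∑ i, x i • EuclideanSpace.basisFun (Fin N) ℝ i = x := by
    intro x
    have := (EuclideanSpace.basisFun (Fin N) ℝ).sum_repr x
    simpa using this
  have hlin : ∀ (L : EuclideanSpace ℝ (Fin N) →L[ℝ] ℝ) (x : EuclideanSpace ℝ (Fin N)),
      L x = ∑ i, x i * L (EuclideanSpace.basisFun (Fin N) ℝ i) := by
    intro L x
    conv_lhs => rw [← hsum x]
    simp [map_sum]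
  have hg : ∀ i : Fin N, ContDiff ℝ 1 (fun x : EuclideanSpace ℝ (Fin N) => k x * x i) := by
    intro i
    exact hk.mul (by fun_prop)
  have hgd : ∀ (i : Fin N) (x : EuclideanSpace ℝ (Fin N)),
      fderiv ℝ (fun x : EuclideanSpace ℝ (Fin N) => k x * x i) x (EuclideanSpace.basisFun (Fin N) ℝ i)
        = k x + x i * fderiv ℝ k x (EuclideanSpace.basisFun (Fin N) ℝ i) := by
    intro i x
    have h1 : HasFDerivAt (fun x : EuclideanSpace ℝ (Fin N) => x i)
        (EuclideanSpace.proj i : EuclideanSpace ℝ (Fin N) →L[ℝ] ℝ) x :=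
      (EuclideanSpace.proj i : EuclideanSpace ℝ (Fin N) →L[ℝ] ℝ).hasFDerivAt
    have h2 : HasFDerivAt (fun x : EuclideanSpace ℝ (Fin N) => k x * x i) _ x :=
      (hkd x).hasFDerivAt.mul h1
    rw [h2.fderiv]
    simp
  have i1 : ∀ i : Fin N, Integrable (fun x : EuclideanSpace ℝ (Fin N) =>
      w x * fderiv ℝ (fun x : EuclideanSpace ℝ (Fin N) => k x * x i) x
        (EuclideanSpace.basisFun (Fin N) ℝ i)) := by
    intro i
    have := (hg i).continuous_fderiv (by norm_num)
    refine Continuous.integrable_of_hasCompactSupport ?_ hwc.mul_right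
    have := hw.continuous
    fun_prop
  have i2 : ∀ i : Fin N, Integrable (fun x : EuclideanSpace ℝ (Fin N) =>
      fderiv ℝ w x (EuclideanSpace.basisFun (Fin N) ℝ i) * (k x * x i)) := by
    intro i
    refine Continuous.integrable_of_hasCompactSupport ?_ (hwc.fderiv_apply (𝕜 := ℝ) _).mul_right
    have := hk.continuous
    fun_prop
  have i3 : ∀ i : Fin N, Integrable (fun x : EuclideanSpace ℝ (Fin N) =>
      w x * (k x * x i)) := by
    intro i
    refine Continuous.integrable_of_hasCompactSupport ?_ hwc.mul_right
    have := hk.continuous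
    have := hw.continuous
    fun_prop
  have key : ∀ i : Fin N, _ := fun i =>
    integral_mul_fderiv_eq_neg_fderiv_mul_of_integrable (i2 i) (i1 i) (i3 i)
      (fun x _ => hwd x) (fun x _ => ((hg i).differentiable (by norm_num)) x)
  have e1 : ∫ x, w x * (N * k x + fderiv ℝ k x x) =
      ∑ i : Fin N, ∫ x, w x * fderiv ℝ (fun x : EuclideanSpace ℝ (Fin N) => k x * x i) x
        (EuclideanSpace.basisFun (Fin N) ℝ i) := by
    rw [← integral_finsetSum _ (fun i _ => i1 i)]
    congr 1
    ext x
    rw [← Finset.mul_sum]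
    simp_rw [hgd]
    rw [Finset.sum_add_distrib, ← hlin]
    simp
  have e2 : ∫ x, fderiv ℝ w x x * k x =
      ∑ i : Fin N, ∫ x, fderiv ℝ w x (EuclideanSpace.basisFun (Fin N) ℝ i) * (k x * x i) := by
    rw [← integral_finsetSum _ (fun i _ => i2 i)]
    congr 1
    ext x
    rw [hlin (fderiv ℝ w x) x, Finset.sum_mul]
    refine Finset.sum_congr rfl fun i _ => by ring
  rw [e1, e2, Finset.sum_congr rfl (fun i _ => key i), Finset.sum_neg_distrib]

/-- Regularised improved Hardy inequality. -/
lemma hardy_reg (N : ℕ) (hN : 3 ≤ N) (φ : EuclideanSpace ℝ (Fin N) → ℝ)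
    (hφ : ContDiff ℝ 1 φ) (hc : HasCompactSupport φ) (R : ℝ) (hR : 0 < R)
    (hs : ∀ x, φ x ≠ 0 → ‖x‖ ≤ R) (ε : ℝ) (hε : 0 < ε) :
    (((N : ℝ) - 2) / 2) ^ 2 * (∫ x, φ x ^ 2 / (‖x‖ ^ 2 + ε)) + 1 / R ^ 2 * ∫ x, φ x ^ 2
      ≤ ∫ x, ‖gradient φ x‖ ^ 2 := by
  have hpos : ∀ x : EuclideanSpace ℝ (Fin N), 0 < ‖x‖ ^ 2 + ε := fun x => by positivity
  have hNr : (3 : ℝ) ≤ N := by exact_mod_cast hN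
  set a : ℝ := ((N : ℝ) - 2) / 2 with ha
  set b : ℝ := 1 / R ^ 2 with hb
  have ha0 : 0 < a := by rw [ha]; linarith
  have hNa : (N : ℝ) = 2 * a + 2 := by rw [ha]; ring
  have hb0 : 0 < b := by positivity
  have hφc := hφ.continuous
  have hφd : Differentiable ℝ φ := hφ.differentiable (by norm_num)
  have hφf : Continuous (fderiv ℝ φ) := hφ.continuous_fderiv (by norm_num)
  have hgrad : ∀ x, gradient φ x = (InnerProductSpace.toDual ℝ _).symm (fderiv ℝ φ x) := fun x => rfl
  have hgc : Continuous (gradient φ) := by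
    have : gradient φ = fun x => (InnerProductSpace.toDual ℝ _).symm (fderiv ℝ φ x) := funext hgrad
    rw [this]
    exact (LinearIsometryEquiv.continuous _).comp hφf
  have hinner : ∀ x v, inner ℝ (gradient φ x) v = fderiv ℝ φ x v := by
    intro x v
    rw [hgrad, InnerProductSpace.toDual_symm_apply]
  set k : EuclideanSpace ℝ (Fin N) → ℝ := fun x => a * (‖x‖ ^ 2 + ε)⁻¹ + b with hkdef
  have hk : ContDiff ℝ 1 k := by
    refine ContDiff.add (contDiff_const.mul (ContDiff.inv ?_ fun x => (hpos x).ne')) contDiff_const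
    exact (contDiff_norm_sq ℝ).add contDiff_const
  have hkc := hk.continuous
  have hkf : Continuous (fderiv ℝ k) := hk.continuous_fderiv (by norm_num)
  have hkd : ∀ x, fderiv ℝ k x x = - (2 * a * ‖x‖ ^ 2 / (‖x‖ ^ 2 + ε) ^ 2) := by
    intro x
    have h1 : HasFDerivAt (fun x : EuclideanSpace ℝ (Fin N) => ‖x‖ ^ 2 + ε)
        (2 • (innerSL ℝ x)) x := ((hasStrictFDerivAt_norm_sq x).hasFDerivAt).add_const ε
    have h3 : HasDerivAt (fun t : ℝ => a * t⁻¹ + b) (a * (-((‖x‖ ^ 2 + ε) ^ 2)⁻¹)) (‖x‖ ^ 2 + ε) :=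
      ((hasDerivAt_inv (hpos x).ne').const_mul a).add_const b
    have h2 : HasFDerivAt k ((a * (-((‖x‖ ^ 2 + ε) ^ 2)⁻¹)) • (2 • (innerSL ℝ x))) x :=
      HasDerivAt.comp_hasFDerivAt (h₂ := fun t : ℝ => a * t⁻¹ + b) x h3 h1
    rw [h2.fderiv]
    simp [real_inner_self_eq_norm_sq]
    field_simp
  have hP := parts_radial N (fun x => φ x ^ 2) k (hφ.pow 2)
    (hc.comp_left (g := fun t : ℝ => t ^ 2) (by simp)) hk
  have hwd : ∀ x, fderiv ℝ (fun x => φ x ^ 2) x x = 2 * φ x * fderiv ℝ φ x x := by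
    intro x
    have := ((hφd x).hasFDerivAt.pow 2)
    rw [this.fderiv]
    simp
  simp_rw [hwd] at hP
  have hc2 : HasCompactSupport (fun x => φ x ^ 2) :=
    hc.comp_left (g := fun t : ℝ => t ^ 2) (by simp)
  have hnsq : Continuous fun x : EuclideanSpace ℝ (Fin N) => ‖x‖ ^ 2 := by fun_prop
  have J1 : Integrable (fun x => φ x ^ 2 / (‖x‖ ^ 2 + ε)) := by
    simp_rw [div_eq_mul_inv]
    refine Continuous.integrable_of_hasCompactSupport ?_ hc2.mul_right
    exact (hφc.pow 2).mul ((hnsq.add continuous_const).inv₀ fun x => (hpos x).ne')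
  have J2 : Integrable (fun x => φ x ^ 2) :=
    Continuous.integrable_of_hasCompactSupport (hφc.pow 2) hc2
  have J3 : Integrable (fun x => ‖gradient φ x‖ ^ 2) := by
    refine Continuous.integrable_of_hasCompactSupport (hgc.norm.pow 2) ?_
    have := (hc.fderiv (𝕜 := ℝ)).comp_left
      (g := fun L => ‖(InnerProductSpace.toDual ℝ (EuclideanSpace ℝ (Fin N))).symm L‖ ^ 2) (by simp)
    exact this
  have J4 : Integrable (fun x => φ x ^ 2 * (N * k x + fderiv ℝ k x x)) := by
    refine Continuous.integrable_of_hasCompactSupport ?_ hc2.mul_right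
    fun_prop
  have J5 : Integrable (fun x => 2 * φ x * fderiv ℝ φ x x * k x) := by
    refine Continuous.integrable_of_hasCompactSupport ?_ ?_
    · fun_prop
    · exact ((hc.mul_left (f := fun _ => (2 : ℝ))).mul_right).mul_right
  have hint : 0 ≤ ∫ x, (‖gradient φ x‖ ^ 2 + 2 * φ x * fderiv ℝ φ x x * k x
      + φ x ^ 2 * (N * k x + fderiv ℝ k x x) - a ^ 2 * (φ x ^ 2 / (‖x‖ ^ 2 + ε))
      - b * φ x ^ 2) := by
    refine integral_nonneg fun x => ?_
    have hsq : 0 ≤ ‖gradient φ x + (φ x * k x) • x‖ ^ 2 := by positivity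
    rw [norm_add_sq_real, inner_smul_right, hinner, norm_smul, mul_pow, Real.norm_eq_abs, sq_abs]
      at hsq
    have hpt : 0 ≤ φ x ^ 2 * ((N * k x + fderiv ℝ k x x) - k x ^ 2 * ‖x‖ ^ 2
        - a ^ 2 / (‖x‖ ^ 2 + ε) - b) := by
      by_cases h0 : φ x = 0
      · simp [h0]
      refine mul_nonneg (sq_nonneg _) ?_
      rw [hkd]
      have hxR := hs x h0
      have hbr : b * ‖x‖ ^ 2 ≤ 1 := by
        rw [hb, div_mul_eq_mul_div, one_mul, div_le_one (by positivity)]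
        gcongr
      have hs0 := hpos x
      have hr0 : 0 ≤ ‖x‖ ^ 2 := by positivity
      simp only [hkdef]
      set r := ‖x‖ ^ 2
      rw [hNa]
      have e : (2 * a + 2) * (a * (r + ε)⁻¹ + b) + -(2 * a * r / (r + ε) ^ 2)
          - (a * (r + ε)⁻¹ + b) ^ 2 * r - a ^ 2 / (r + ε) - b
          = (2 * a + a ^ 2) * ε / (r + ε) ^ 2 + 2 * a * b * ε / (r + ε) + b * (1 - b * r) := by
        field_simp
        ring
      rw [e]
      have : 0 ≤ 1 - b * r := by linarith
      positivity
    have : φ x ^ 2 * ((N * k x + fderiv ℝ k x x) - k x ^ 2 * ‖x‖ ^ 2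
        - a ^ 2 / (‖x‖ ^ 2 + ε) - b) = φ x ^ 2 * (N * k x + fderiv ℝ k x x)
        - (φ x * k x) ^ 2 * ‖x‖ ^ 2 - a ^ 2 * (φ x ^ 2 / (‖x‖ ^ 2 + ε)) - b * φ x ^ 2 := by ring
    simp only [Pi.zero_apply]
    nlinarith
  have K1 : Integrable (fun x => ‖gradient φ x‖ ^ 2 + 2 * φ x * fderiv ℝ φ x x * k x) := J3.add J5
  have K2 : Integrable (fun x => ‖gradient φ x‖ ^ 2 + 2 * φ x * fderiv ℝ φ x x * k x
      + φ x ^ 2 * (N * k x + fderiv ℝ k x x)) := K1.add J4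
  have K3 : Integrable (fun x => ‖gradient φ x‖ ^ 2 + 2 * φ x * fderiv ℝ φ x x * k x
      + φ x ^ 2 * (N * k x + fderiv ℝ k x x) - a ^ 2 * (φ x ^ 2 / (‖x‖ ^ 2 + ε))) :=
    K2.sub (J1.const_mul _)
  rw [integral_sub K3 (J2.const_mul _), integral_sub K2 (J1.const_mul _),
    integral_add K1 J4, integral_add J3 J5, integral_const_mul, integral_const_mul, hP]
    at hint
  linarith

/-- Improved Hardy inequality. -/
lemma hardy_improved (N : ℕ) (hN : 3 ≤ N) (φ : EuclideanSpace ℝ (Fin N) → ℝ)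
    (hφ : ContDiff ℝ 1 φ) (hc : HasCompactSupport φ) (R : ℝ) (hR : 0 < R)
    (hs : ∀ x, φ x ≠ 0 → ‖x‖ ≤ R) :
    (((N : ℝ) - 2) / 2) ^ 2 * (∫ x, φ x ^ 2 / ‖x‖ ^ 2) + 1 / R ^ 2 * ∫ x, φ x ^ 2
      ≤ ∫ x, ‖gradient φ x‖ ^ 2 := by
  by_cases hi : Integrable (fun x => φ x ^ 2 / ‖x‖ ^ 2)
  · have : Nontrivial (EuclideanSpace ℝ (Fin N)) := by
      have : Nonempty (Fin N) := ⟨⟨0, by omega⟩⟩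
      infer_instance
    have hne : ∀ᵐ x : EuclideanSpace ℝ (Fin N), x ≠ 0 := by
      simp [ae_iff]
    have hlim : Filter.Tendsto (fun ε : ℝ => ∫ x, φ x ^ 2 / (‖x‖ ^ 2 + ε))
        (nhdsWithin 0 (Set.Ioi 0)) (nhds (∫ x, φ x ^ 2 / ‖x‖ ^ 2)) := by
      refine tendsto_integral_filter_of_dominated_convergence
        (fun x => φ x ^ 2 / ‖x‖ ^ 2) ?_ ?_ hi ?_
      · refine Filter.Eventually.of_forall fun ε => ?_
        have := hφ.continuous.measurable
        exact Measurable.aestronglyMeasurable (by fun_prop)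
      · filter_upwards [self_mem_nhdsWithin] with ε hε
        filter_upwards [hne] with x hx
        have hε' : (0 : ℝ) < ε := hε
        have : 0 < ‖x‖ := norm_pos_iff.2 hx
        rw [Real.norm_of_nonneg (by positivity)]
        gcongr
        linarith
      · filter_upwards [hne] with x hx
        have : 0 < ‖x‖ := norm_pos_iff.2 hx
        have h : Filter.Tendsto (fun ε : ℝ => φ x ^ 2 / (‖x‖ ^ 2 + ε)) (nhds 0)
            (nhds (φ x ^ 2 / (‖x‖ ^ 2 + 0))) := by
          refine Filter.Tendsto.div tendsto_const_nhds (tendsto_const_nhds.add Filter.tendsto_id) ?_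
          positivity
        rw [add_zero] at h
        exact h.mono_left nhdsWithin_le_nhds
    refine le_of_tendsto ((hlim.const_mul _).add_const _) ?_
    filter_upwards [self_mem_nhdsWithin] with ε hε
    exact hardy_reg N hN φ hφ hc R hR hs ε hε
  · rw [integral_undef hi]
    have h := hardy_reg N hN φ hφ hc R hR hs 1 one_pos
    have : 0 ≤ (((N : ℝ) - 2) / 2) ^ 2 * (∫ x, φ x ^ 2 / (‖x‖ ^ 2 + 1)) :=
      mul_nonneg (sq_nonneg _) (integral_nonneg fun x => by positivity)
    linarith

/-- **Behavior of the principal eigenvalue as `μ ↑ μ*`.**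
`λ₁` is antitone on `(0, μ*]`, `λ₁(μ*) > 0`, and there is `λ_* ≥ λ₁(μ*)` such that
`λ₁(μ) → λ_*` as `μ → μ*` from the left. -/
theorem principalEigenvalue_behavior (N : ℕ) (hN : 3 ≤ N)
    (Ω : Set (EuclideanSpace ℝ (Fin N))) (hΩo : IsOpen Ω) (hΩb : Bornology.IsBounded Ω)
    (hΩne : Ω.Nonempty) :
    (∀ μ₁ μ₂ : ℝ, 0 < μ₁ → μ₁ < μ₂ → μ₂ ≤ (((N : ℝ) - 2) / 2) ^ 2 →
        principalEigenvalue N Ω μ₂ ≤ principalEigenvalue N Ω μ₁) ∧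
      0 < principalEigenvalue N Ω ((((N : ℝ) - 2) / 2) ^ 2) ∧
      ∃ lstar : ℝ, principalEigenvalue N Ω ((((N : ℝ) - 2) / 2) ^ 2) ≤ lstar ∧
        Filter.Tendsto (fun μ => principalEigenvalue N Ω μ)
          (nhdsWithin ((((N : ℝ) - 2) / 2) ^ 2) (Set.Iio ((((N : ℝ) - 2) / 2) ^ 2)))
          (nhds lstar) := by
  obtain ⟨R, hR, hΩR⟩ : ∃ R : ℝ, 0 < R ∧ ∀ x ∈ Ω, ‖x‖ ≤ R := by
    obtain ⟨R, hR, h⟩ := hΩb.exists_pos_norm_le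
    exact ⟨R, hR, h⟩
  have hpos : ∀ φ : EuclideanSpace ℝ (Fin N) → ℝ, ContDiff ℝ (⊤ : ℕ∞) φ → HasCompactSupport φ →
      tsupport φ ⊆ Ω → φ ≠ 0 → 0 < ∫ x in Ω, (φ x) ^ 2 := by
    intro φ h1 h2 h3 h4
    obtain ⟨x, hx⟩ := Function.ne_iff.1 h4
    rw [setIntegral_eq_integral_of_forall_compl_eq_zero]
    · refine Continuous.integral_pos_of_hasCompactSupport_nonneg_nonzero (x := x)
        (h1.continuous.pow 2) (h2.comp_left (g := fun t : ℝ => t ^ 2) (by simp))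
        (fun x => sq_nonneg _) ?_
      exact pow_ne_zero 2 hx
    · intro x hx
      have : φ x = 0 := image_eq_zero_of_notMem_tsupport fun h => hx (h3 h)
      simp [this]
  have hnn : ∀ φ : EuclideanSpace ℝ (Fin N) → ℝ, 0 ≤ ∫ x in Ω, (φ x) ^ 2 / ‖x‖ ^ 2 :=
    fun φ => integral_nonneg fun x => by positivity
  have hlow : ∀ μ : ℝ, μ ≤ (((N : ℝ) - 2) / 2) ^ 2 →
      ∀ t ∈ { t : ℝ | ∃ φ : EuclideanSpace ℝ (Fin N) → ℝ,
        ContDiff ℝ (⊤ : ℕ∞) φ ∧ HasCompactSupport φ ∧ tsupport φ ⊆ Ω ∧ φ ≠ 0 ∧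
        t = ((∫ x in Ω, ‖gradient φ x‖ ^ 2) - μ * ∫ x in Ω, (φ x) ^ 2 / ‖x‖ ^ 2) /
          ∫ x in Ω, (φ x) ^ 2 }, 1 / R ^ 2 ≤ t := by
    rintro μ hμ t ⟨φ, h1, h2, h3, h4, rfl⟩
    have hz : ∀ x, x ∉ Ω → φ x = 0 := fun x hx =>
      image_eq_zero_of_notMem_tsupport fun h => hx (h3 h)
    rw [le_div_iff₀ (hpos φ h1 h2 h3 h4)]
    have hmul := mul_le_mul_of_nonneg_right hμ (hnn φ)
    have hH := hardy_improved N hN φ (h1.of_le (by exact_mod_cast le_top)) h2 R hR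
      (fun x hx => hΩR x (by by_contra h; exact hx (hz x h)))
    rw [← setIntegral_eq_integral_of_forall_compl_eq_zero (s := Ω)
        (f := fun x => φ x ^ 2 / ‖x‖ ^ 2) (fun x hx => by simp [hz x hx]),
      ← setIntegral_eq_integral_of_forall_compl_eq_zero (s := Ω)
        (f := fun x => φ x ^ 2) (fun x hx => by simp [hz x hx]),
      ← setIntegral_eq_integral_of_forall_compl_eq_zero (s := Ω)
        (f := fun x => ‖gradient φ x‖ ^ 2) (fun x hx => by
          have : fderiv ℝ φ x = 0 := fderiv_of_notMem_tsupport (𝕜 := ℝ) fun h => hx (h3 h)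
          simp [gradient, this])] at hH
    linarith
  have hne : ∀ μ : ℝ, { t : ℝ | ∃ φ : EuclideanSpace ℝ (Fin N) → ℝ,
        ContDiff ℝ (⊤ : ℕ∞) φ ∧ HasCompactSupport φ ∧ tsupport φ ⊆ Ω ∧ φ ≠ 0 ∧
        t = ((∫ x in Ω, ‖gradient φ x‖ ^ 2) - μ * ∫ x in Ω, (φ x) ^ 2 / ‖x‖ ^ 2) /
          ∫ x in Ω, (φ x) ^ 2 }.Nonempty := by
    intro μ
    obtain ⟨x, hx⟩ := hΩne
    obtain ⟨f, hf1, hf2, hf3, -, hf5⟩ :=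
      exists_contDiff_tsupport_subset (n := ⊤) (hΩo.mem_nhds hx)
    exact ⟨_, f, hf3, hf2, hf1, fun h => by simp [h] at hf5, rfl⟩
  have hanti : ∀ μ₁ μ₂ : ℝ, μ₁ ≤ μ₂ → μ₂ ≤ (((N : ℝ) - 2) / 2) ^ 2 →
      principalEigenvalue N Ω μ₂ ≤ principalEigenvalue N Ω μ₁ := by
    intro μ₁ μ₂ h12 h2
    unfold principalEigenvalue
    refine le_csInf (hne μ₁) ?_
    rintro t ⟨φ, h1, h3, h4, h5, rfl⟩
    refine (csInf_le ⟨_, fun t ht => hlow μ₂ h2 t ht⟩ ⟨φ, h1, h3, h4, h5, rfl⟩).trans ?_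
    have := hpos φ h1 h3 h4 h5
    have := mul_le_mul_of_nonneg_right h12 (hnn φ)
    gcongr
  refine ⟨fun μ₁ μ₂ _ h h' => hanti μ₁ μ₂ h.le h', ?_, ?_⟩
  · have : (0 : ℝ) < 1 / R ^ 2 := by positivity
    exact this.trans_le (le_csInf (hne _) (hlow _ le_rfl))
  · have hb : ∀ t ∈ (fun μ => principalEigenvalue N Ω μ) '' Set.Iio ((((N : ℝ) - 2) / 2) ^ 2),
        principalEigenvalue N Ω ((((N : ℝ) - 2) / 2) ^ 2) ≤ t := by
      rintro t ⟨μ, hμ, rfl⟩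
      exact hanti μ _ (le_of_lt hμ) le_rfl
    refine ⟨_, ?_, AntitoneOn.tendsto_nhdsLT ?_ ⟨_, hb⟩⟩
    · exact le_csInf (Set.nonempty_Iio.image _) hb
    · intro μ₁ _ μ₂ h2 h
      exact hanti μ₁ μ₂ h (le_of_lt h2)
end

section
/- Let N ≥ 3, let Ω ⊆ ℝ^N be a measurable set of finite Lebesgue measure |Ω|, let 0 < μ ≤ μ*, λ > 0 and γ > 0. Let u : Ω → ℝ be measurable such that the integrals ∫_Ω ‖∇u‖² dx, ∫_Ω u²/‖x‖² dx, ∫_Ω u² dx and ∫_Ω |u|^{2γ+2} dx are all finite (with ∇u the gradient of u, assumed differentiable), and suppose the energy identity ∫_Ω ‖∇u‖² dx − μ ∫_Ω u²/‖x‖² dx = λ ∫_Ω u² dx − ∫_Ω |u|^{2γ+2} dx holds. Then ∫_Ω ‖∇u‖² dx − μ ∫_Ω u²/‖x‖² dx ≤ R₀, where R₀ = (2λ)^{(γ+1)/γ} · 2^{1/γ} · γ · (γ+1)^{−(γ+1)/γ} · |Ω|. (Any nonnegative solution on the bifurcation branch is bounded in H_μ(Ω) by the explicit constant R₀ for each fixed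 λ.) -/
open MeasureTheory

/-- Pointwise Young inequality with the sharp constant. -/
lemma young_pointwise (lam γ t : ℝ) (hlam : 0 < lam) (hγ : 0 < γ) (ht : 0 ≤ t) :
    lam * t - t ^ (γ + 1) ≤ lam ^ ((γ + 1) / γ) * γ * (γ + 1) ^ (-(γ + 1) / γ) := by
  have hp : 0 < γ + 1 := by linarith
  have hpq : (γ + 1).HolderConjugate ((γ + 1) / γ) := by
    rw [Real.holderConjugate_iff]
    refine ⟨by linarith, ?_⟩
    field_simp
    ring
  have hc : 0 < (γ + 1) ^ (1 / (γ + 1)) := Real.rpow_pos_of_pos hp _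
  have h := Real.young_inequality_of_nonneg
    (a := (γ + 1) ^ (1 / (γ + 1)) * t) (b := lam / (γ + 1) ^ (1 / (γ + 1)))
    (by positivity) (by positivity) hpq
  have e1 : (γ + 1) ^ (1 / (γ + 1)) * t * (lam / (γ + 1) ^ (1 / (γ + 1))) = lam * t := by
    field_simp
  have e2 : ((γ + 1) ^ (1 / (γ + 1)) * t) ^ (γ + 1) / (γ + 1) = t ^ (γ + 1) := by
    rw [Real.mul_rpow hc.le ht, ← Real.rpow_mul hp.le, one_div_mul_cancel hp.ne', Real.rpow_one]
    field_simp
  have e3 : (lam / (γ + 1) ^ (1 / (γ + 1))) ^ ((γ + 1) / γ) / ((γ + 1) / γ)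
      = lam ^ ((γ + 1) / γ) * γ * (γ + 1) ^ (-(γ + 1) / γ) := by
    rw [Real.div_rpow hlam.le hc.le, ← Real.rpow_mul hp.le]
    have a1 : 1 / (γ + 1) * ((γ + 1) / γ) = 1 / γ := by field_simp
    have a2 : -(γ + 1) / γ = -(1 / γ) - 1 := by field_simp; ring
    rw [a1, a2, Real.rpow_sub hp, Real.rpow_neg hp.le, Real.rpow_one]
    field_simp
  rw [e1, e2, e3] at h
  linarith

/-- **`H_μ`-bound for solutions on the bifurcation branch.**
If `u` satisfies the stationary energy identity
`∫_Ω ‖∇u‖² − μ ∫_Ω u²/‖x‖² = λ ∫_Ω u² − ∫_Ω |u|^{2γ+2}`, then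
`∫_Ω ‖∇u‖² − μ ∫_Ω u²/‖x‖² ≤ R₀` with
`R₀ = (2λ)^{(γ+1)/γ} · 2^{1/γ} · γ · (γ+1)^{−(γ+1)/γ} · |Ω|`. -/
theorem branch_bounded_in_Hmu (N : ℕ) (hN : 3 ≤ N)
    (Ω : Set (EuclideanSpace ℝ (Fin N))) (hΩm : MeasurableSet Ω)
    (hΩfin : volume Ω < ⊤)
    (μ lam γ : ℝ) (hμ0 : 0 < μ) (hμ : μ ≤ (((N : ℝ) - 2) / 2) ^ 2)
    (hlam : 0 < lam) (hγ : 0 < γ)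
    (u : EuclideanSpace ℝ (Fin N) → ℝ) (hu : Measurable u)
    (hdiff : Differentiable ℝ u)
    (hint1 : IntegrableOn (fun x => ‖gradient u x‖ ^ 2) Ω)
    (hint2 : IntegrableOn (fun x => (u x) ^ 2 / ‖x‖ ^ 2) Ω)
    (hint3 : IntegrableOn (fun x => (u x) ^ 2) Ω)
    (hint4 : IntegrableOn (fun x => |u x| ^ (2 * γ + 2)) Ω)
    (henergy : (∫ x in Ω, ‖gradient u x‖ ^ 2) - μ * (∫ x in Ω, (u x) ^ 2 / ‖x‖ ^ 2) =
      lam * (∫ x in Ω, (u x) ^ 2) - ∫ x in Ω, |u x| ^ (2 * γ + 2)) :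
    (∫ x in Ω, ‖gradient u x‖ ^ 2) - μ * (∫ x in Ω, (u x) ^ 2 / ‖x‖ ^ 2) ≤
      (2 * lam) ^ ((γ + 1) / γ) * 2 ^ (1 / γ) * γ * (γ + 1) ^ (-(γ + 1) / γ) *
        (volume Ω).toReal := by
  rw [henergy, ← integral_const_mul, ← integral_sub (hint3.const_mul lam) hint4]
  set C := (2 * lam) ^ ((γ + 1) / γ) * 2 ^ (1 / γ) * γ * (γ + 1) ^ (-(γ + 1) / γ) with hC
  have hpt : ∀ x, lam * (u x) ^ 2 - |u x| ^ (2 * γ + 2) ≤ C := by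
    intro x
    have h := young_pointwise lam γ (|u x| ^ (2 : ℝ)) hlam hγ (by positivity)
    rw [← Real.rpow_mul (abs_nonneg _)] at h
    have e : (2 : ℝ) * (γ + 1) = 2 * γ + 2 := by ring
    rw [e, Real.rpow_two, sq_abs] at h
    refine h.trans ?_
    have h1 : lam ^ ((γ + 1) / γ) ≤ (2 * lam) ^ ((γ + 1) / γ) :=
      Real.rpow_le_rpow hlam.le (by linarith) (by positivity)
    have h2 : (1 : ℝ) ≤ 2 ^ (1 / γ) := Real.one_le_rpow (by norm_num) (by positivity)
    have h3 : lam ^ ((γ + 1) / γ) ≤ (2 * lam) ^ ((γ + 1) / γ) * 2 ^ (1 / γ) :=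
      h1.trans (le_mul_of_one_le_right (by positivity) h2)
    rw [hC]
    gcongr
  calc ∫ x in Ω, (lam * (u x) ^ 2 - |u x| ^ (2 * γ + 2))
      ≤ ∫ x in Ω, C := by
        refine integral_mono ((hint3.const_mul lam).sub hint4) ?_ hpt
        exact integrableOn_const hΩfin.ne
    _ = C * (volume Ω).toReal := by
        rw [setIntegral_const, smul_eq_mul, mul_comm, Measure.real]
end

section
/- Let N ≥ 3, let Ω ⊆ ℝ^N be an open set, and let u : ℝ^N → ℝ be smooth with compact support contained in Ω \ {0}. Define v : ℝ^N → ℝ by v(x) = ‖x‖^{(N−2)/2} u(x) for x ≠ 0 and v(0) = 0. Then ∫_{ℝ^N} ‖∇u(x)‖² dx − μ* ∫_{ℝ^N} u(x)²/‖x‖² dx = ∫_{ℝ^N} ‖x‖^{−(N−2)} ‖∇v(x)‖² dx. (This identity underlies the fact that u ∈ H_{μ*}(Ω) if and only if ‖x‖^{(N−2)/2} u belongs to the weighted space W_0^{1,2}(Ω; ‖x‖^{−(N−2)}).) -/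
open MeasureTheory

lemma wsi_smooth {N : ℕ} (u : EuclideanSpace ℝ (Fin N) → ℝ)
    (hu : ContDiff ℝ (⊤ : ℕ∞) u) (h0 : (0 : EuclideanSpace ℝ (Fin N)) ∉ tsupport u) :
    ContDiff ℝ (⊤ : ℕ∞) (fun x => (u x) ^ 2 / ‖x‖ ^ 2) := by
  rw [contDiff_iff_contDiffAt]
  intro x
  by_cases hx : x = 0
  · subst hx
    have h : u =ᶠ[nhds 0] 0 := notMem_tsupport_iff_eventuallyEq.mp h0
    have h2 : (fun x => (u x) ^ 2 / ‖x‖ ^ 2) =ᶠ[nhds 0] fun _ => (0 : ℝ) := by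
      filter_upwards [h] with y hy
      simp [hy]
    exact contDiffAt_const.congr_of_eventuallyEq h2
  · refine ContDiffAt.div (hu.contDiffAt.pow 2) (contDiff_norm_sq ℝ).contDiffAt ?_
    have := norm_pos_iff.mpr hx
    positivity

lemma wsi_parts {N : ℕ} (w : EuclideanSpace ℝ (Fin N) → ℝ)
    (hw : ContDiff ℝ (⊤ : ℕ∞) w) (hc : HasCompactSupport w) :
    ∫ x, fderiv ℝ w x x = -(N : ℝ) * ∫ x, w x := by
  have hcf : HasCompactSupport (fderiv ℝ w) := hc.fderiv ℝ
  have hwc : Continuous (fderiv ℝ w) := hw.continuous_fderiv (by simp)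
  let e : Fin N → EuclideanSpace ℝ (Fin N) := fun i => EuclideanSpace.single i 1
  have hci : ∀ i, Continuous (fun x : EuclideanSpace ℝ (Fin N) => x i) := fun i => by fun_prop
  have hI : ∀ i, Integrable (fun x : EuclideanSpace ℝ (Fin N) => x i * fderiv ℝ w x (e i)) := by
    intro i
    apply Continuous.integrable_of_hasCompactSupport (by fun_prop)
    apply hcf.mono'
    intro x hx
    apply subset_tsupport
    intro h
    simp [h] at hx
  have hIw : Integrable w := hw.continuous.integrable_of_hasCompactSupport hc
  have hdec : ∀ x, fderiv ℝ w x x = ∑ i, x i * fderiv ℝ w x (e i) := by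
    intro x
    have hx : x = ∑ i, x i • e i := by
      ext j
      simp [e, Finset.sum_apply, Pi.single_apply]
    have h2 := congrArg (fderiv ℝ w x) hx
    rw [map_sum] at h2
    simpa using h2
  simp_rw [hdec]
  rw [integral_finsetSum _ (fun i _ => hI i)]
  have key : ∀ i, ∫ x : EuclideanSpace ℝ (Fin N), x i * fderiv ℝ w x (e i) = - ∫ x, w x := by
    intro i
    have hp : ∀ x : EuclideanSpace ℝ (Fin N),
        HasFDerivAt (fun y : EuclideanSpace ℝ (Fin N) => y i)
          (EuclideanSpace.proj i : EuclideanSpace ℝ (Fin N) →L[ℝ] ℝ) x :=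
      fun x => (EuclideanSpace.proj i : EuclideanSpace ℝ (Fin N) →L[ℝ] ℝ).hasFDerivAt
    have hd : ∀ x : EuclideanSpace ℝ (Fin N),
        fderiv ℝ (fun y : EuclideanSpace ℝ (Fin N) => y i) x (e i) = 1 := by
      intro x
      rw [(hp x).fderiv]
      simp [e]
    rw [integral_mul_fderiv_eq_neg_fderiv_mul_of_integrable]
    · simp_rw [hd]; simp
    · simp_rw [hd]; simpa using hIw
    · exact hI i
    · exact ((hci i).mul hw.continuous).integrable_of_hasCompactSupport hc.mul_left
    · exact fun x _ => (hp x).differentiableAt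
    · exact fun x _ => hw.differentiable (by simp) x
  simp [key]

lemma wsi_pointwise {N : ℕ} (a : ℝ) (u v : EuclideanSpace ℝ (Fin N) → ℝ)
    (hu : ContDiff ℝ (⊤ : ℕ∞) u) (h0 : (0 : EuclideanSpace ℝ (Fin N)) ∉ tsupport u)
    (hv : ∀ x, v x = ‖x‖ ^ a * u x) (x : EuclideanSpace ℝ (Fin N)) :
    ‖x‖ ^ (-(2 * a)) * ‖gradient v x‖ ^ 2 =
      ‖gradient u x‖ ^ 2 + a * fderiv ℝ (fun x => (u x) ^ 2 / ‖x‖ ^ 2) x x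
        + (2 * a + a ^ 2) * ((u x) ^ 2 / ‖x‖ ^ 2) := by
  by_cases hx : x = 0
  · subst hx
    have h : u =ᶠ[nhds 0] fun _ => 0 := notMem_tsupport_iff_eventuallyEq.mp h0
    have h2 : v =ᶠ[nhds 0] fun _ => 0 := by
      filter_upwards [h] with y hy
      simp [hv, hy]
    simp [gradient, h.fderiv_eq, h2.fderiv_eq]
  have hr : 0 < ‖x‖ := norm_pos_iff.mpr hx
  have hud : HasFDerivAt u (fderiv ℝ u x) x := (hu.differentiable (by simp) x).hasFDerivAt
  have hsq : HasFDerivAt (fun y : EuclideanSpace ℝ (Fin N) => ‖y‖ ^ 2)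
      (2 • (innerSL ℝ x)) x := (hasStrictFDerivAt_norm_sq x).hasFDerivAt
  have hpow : HasFDerivAt (fun y : EuclideanSpace ℝ (Fin N) => ‖y‖ ^ a)
      ((a * ‖x‖ ^ (a - 2)) • (innerSL ℝ x)) x := by
    have h1 := hsq.rpow_const (p := a / 2) (Or.inl (by positivity))
    have h2 : (fun y : EuclideanSpace ℝ (Fin N) => (‖y‖ ^ 2) ^ (a / 2)) = fun y => ‖y‖ ^ a := by
      ext y
      rw [← Real.rpow_natCast, ← Real.rpow_mul (norm_nonneg _)]
      congr 1; push_cast; ring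
    rw [h2] at h1
    refine h1.congr_fderiv ?_
    symm
    rw [← Real.rpow_natCast, ← Real.rpow_mul (norm_nonneg _), ← Nat.cast_smul_eq_nsmul ℝ, smul_smul]
    congr 1
    have : ((2 : ℕ) : ℝ) * (a / 2 - 1) = a - 2 := by push_cast; ring
    rw [this]; push_cast; ring
  have hvf : v = fun y => ‖y‖ ^ a * u y := funext hv
  have hgu : ∀ y, fderiv ℝ u x y = inner ℝ (gradient u x) y := by
    intro y; simp [gradient]
  have hgv : gradient v x = ‖x‖ ^ a • gradient u x + (a * ‖x‖ ^ (a - 2) * u x) • x := by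
    have h1 := hpow.mul hud
    apply HasGradientAt.gradient
    rw [hasGradientAt_iff_hasFDerivAt, hvf]
    refine HasFDerivAt.congr_fderiv (f := fun y => ‖y‖ ^ a * u y) h1 ?_
    ext y
    simp [inner_add_left]
    ring
  have hw : fderiv ℝ (fun x => (u x) ^ 2 / ‖x‖ ^ 2) x x =
      2 * u x * inner ℝ (gradient u x) x / ‖x‖ ^ 2 - 2 * (u x ^ 2 / ‖x‖ ^ 2) := by
    have hwd : HasFDerivAt (fun x => (u x) ^ 2 / ‖x‖ ^ 2)
        (fderiv ℝ (fun x => (u x) ^ 2 / ‖x‖ ^ 2) x) x :=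
      ((wsi_smooth u hu h0).differentiable (by simp) x).hasFDerivAt
    have hu0 : u 0 = 0 := image_eq_zero_of_notMem_tsupport h0
    have h1 := hwd.mul hsq
    have h2 : ((fun x => (u x) ^ 2 / ‖x‖ ^ 2) * (fun x => ‖x‖ ^ 2)) = fun x => u x ^ 2 := by
      ext y
      by_cases hy : y = 0
      · simp [hy, hu0]
      · have := norm_pos_iff.mpr hy
        simp only [Pi.mul_apply]
        field_simp
    rw [h2] at h1
    have h3 := congrArg (fun L => L x) (h1.unique (hud.pow 2))
    simp at h3
    rw [← hgu]
    field_simp at h3 ⊢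
    linarith
  rw [hw, hgv, norm_add_sq_real]
  have e1 : ‖x‖ ^ (a - 2) = ‖x‖ ^ a / ‖x‖ ^ 2 := by
    rw [Real.rpow_sub hr]; norm_num
  have e2 : ‖x‖ ^ (-(2 * a)) = ((‖x‖ ^ a) ^ 2)⁻¹ := by
    rw [Real.rpow_neg hr.le, ← Real.rpow_natCast, ← Real.rpow_mul hr.le]
    congr 2; push_cast; ring
  rw [e1, e2]
  have hp : 0 < ‖x‖ ^ a := Real.rpow_pos_of_pos hr a
  simp only [norm_smul, inner_smul_left, inner_smul_right, mul_pow, Real.norm_eq_abs, sq_abs]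
  simp
  generalize ‖x‖ ^ a = p at *
  field_simp
  ring

/-- **Weighted-space identity.**
For `u` smooth with compact support in `Ω \ {0}` and `v(x) = ‖x‖^{(N−2)/2} u(x)`,
`∫ ‖∇u‖² − μ* ∫ u²/‖x‖² = ∫ ‖x‖^{−(N−2)} ‖∇v‖²`. -/
theorem weighted_space_identity (N : ℕ) (hN : 3 ≤ N)
    (Ω : Set (EuclideanSpace ℝ (Fin N))) (hΩ : IsOpen Ω)
    (u : EuclideanSpace ℝ (Fin N) → ℝ)
    (hu : ContDiff ℝ (⊤ : ℕ∞) u) (hc : HasCompactSupport u)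
    (hsupp : tsupport u ⊆ Ω \ {0})
    (v : EuclideanSpace ℝ (Fin N) → ℝ)
    (hv : ∀ x, v x = ‖x‖ ^ (((N : ℝ) - 2) / 2) * u x) :
    (∫ x, ‖gradient u x‖ ^ 2) -
        (((N : ℝ) - 2) / 2) ^ 2 * (∫ x, (u x) ^ 2 / ‖x‖ ^ 2) =
      ∫ x, ‖x‖ ^ (-((N : ℝ) - 2)) * ‖gradient v x‖ ^ 2 := by
  have h0 : (0 : EuclideanSpace ℝ (Fin N)) ∉ tsupport u := fun h => (hsupp h).2 rfl
  have hwS := wsi_smooth u hu h0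
  have hwC : HasCompactSupport (fun x => (u x) ^ 2 / ‖x‖ ^ 2) := by
    apply hc.mono
    intro x hx h
    simp [h] at hx
  have hparts := wsi_parts _ hwS hwC
  have hpt := wsi_pointwise (((N : ℝ) - 2) / 2) u v hu h0 hv
  have e : -(2 * (((N : ℝ) - 2) / 2)) = -((N : ℝ) - 2) := by ring
  rw [e] at hpt
  simp_rw [hpt]
  have hwc := hwS.continuous_fderiv (by simp)
  have I1 : Integrable (fun x => ‖gradient u x‖ ^ 2) := by
    have hn : ∀ x, ‖gradient u x‖ = ‖fderiv ℝ u x‖ := fun x => by simp [gradient]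
    simp_rw [hn]
    have hcu := hu.continuous_fderiv (by simp)
    apply Continuous.integrable_of_hasCompactSupport (by fun_prop)
    apply (hc.fderiv ℝ).mono
    intro x hx h
    simp [h] at hx
  have I2 : Integrable (fun x => fderiv ℝ (fun x => (u x) ^ 2 / ‖x‖ ^ 2) x x) := by
    apply Continuous.integrable_of_hasCompactSupport (hwc.clm_apply continuous_id)
    apply (hwC.fderiv ℝ).mono
    intro x hx h
    simp [h] at hx
  have I3 : Integrable (fun x => (u x) ^ 2 / ‖x‖ ^ 2) :=
    hwS.continuous.integrable_of_hasCompactSupport hwC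
  have I12 : Integrable (fun x => ‖gradient u x‖ ^ 2 +
      ((N : ℝ) - 2) / 2 * fderiv ℝ (fun x => (u x) ^ 2 / ‖x‖ ^ 2) x x) := I1.add (I2.const_mul _)
  rw [integral_add I12 (I3.const_mul _),
    integral_add I1 (I2.const_mul _), integral_const_mul, integral_const_mul, hparts]
  ring
end

section
/- Let (X, 𝔐, ν) be a measure space, let γ > 0 with 2γ ≠ 1, and let u, v : X → ℝ be measurable functions with 0 < u(x) ≤ v(x) for ν-almost every x. Assume that u^{2γ} v and v^{2γ} u are ν-integrable and that ∫_X ( u^{2γ} v − v^{2γ} u ) dν = 0. Then u = v ν-almost everywhere. (This is the comparison step proving uniqueness of the nonnegative stationary solution: for u ≤ v the integrand u^{2γ}v − v^{2γ}u has a definite sign, vanishing exactly where u = v.) -/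
open MeasureTheory

theorem comparison_pow_split (p a : ℝ) (ha : 0 < a) : a ^ p = a ^ (p - 1) * a := by
  rw [Real.rpow_sub_one ha.ne']
  field_simp

theorem comparison_pointwise (p a b : ℝ) (ha : 0 < a) (hb : 0 < b) :
    a ^ p * b - b ^ p * a = a * b * (a ^ (p - 1) - b ^ (p - 1)) := by
  rw [comparison_pow_split p a ha, comparison_pow_split p b hb]
  ring

/-- **Uniqueness comparison step.**
If `0 < u ≤ v` a.e., `2γ ≠ 1`, `u^{2γ}v` and `v^{2γ}u` are integrable and
`∫ (u^{2γ}v − v^{2γ}u) dν = 0`, then `u = v` a.e. -/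
theorem comparison_uniqueness {X : Type*} [MeasurableSpace X] (ν : Measure X)
    (γ : ℝ) (hγ : 0 < γ) (hγ' : 2 * γ ≠ 1)
    (u v : X → ℝ)
    (huv : ∀ᵐ x ∂ν, 0 < u x ∧ u x ≤ v x)
    (hint1 : Integrable (fun x => u x ^ (2 * γ) * v x) ν)
    (hint2 : Integrable (fun x => v x ^ (2 * γ) * u x) ν)
    (hzero : ∫ x, (u x ^ (2 * γ) * v x - v x ^ (2 * γ) * u x) ∂ν = 0) :
    u =ᵐ[ν] v := by
  have hint := hint1.sub hint2
  have key : ∀ᵐ x ∂ν, u x ^ (2 * γ) * v x - v x ^ (2 * γ) * u x = 0 := by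
    rcases lt_or_gt_of_ne hγ' with h | h
    · have hnn : 0 ≤ᵐ[ν] fun x => u x ^ (2 * γ) * v x - v x ^ (2 * γ) * u x := by
        filter_upwards [huv] with x hx
        have hv : 0 < v x := hx.1.trans_le hx.2
        have := Real.rpow_le_rpow_of_nonpos hx.1 hx.2 (by linarith : 2 * γ - 1 ≤ 0)
        simp only [Pi.zero_apply]
        rw [comparison_pointwise _ _ _ hx.1 hv]
        exact mul_nonneg (mul_pos hx.1 hv).le (by linarith)
      exact (integral_eq_zero_iff_of_nonneg_ae hnn hint).1 hzero
    · have hnn : 0 ≤ᵐ[ν] fun x => -(u x ^ (2 * γ) * v x - v x ^ (2 * γ) * u x) := by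
        filter_upwards [huv] with x hx
        have hv : 0 < v x := hx.1.trans_le hx.2
        have := Real.rpow_le_rpow hx.1.le hx.2 (by linarith : 0 ≤ 2 * γ - 1)
        simp only [Pi.zero_apply]
        rw [comparison_pointwise _ _ _ hx.1 hv, ← mul_neg]
        exact mul_nonneg (mul_pos hx.1 hv).le (by linarith)
      have h0 := (integral_eq_zero_iff_of_nonneg_ae hnn hint.neg).1
        (by rw [integral_neg, hzero, neg_zero])
      filter_upwards [h0] with x hx
      exact neg_eq_zero.1 hx
  filter_upwards [huv, key] with x hx hk
  have hv : 0 < v x := hx.1.trans_le hx.2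
  rw [comparison_pointwise _ _ _ hx.1 hv] at hk
  have h1 := (mul_eq_zero.1 hk).resolve_left (mul_pos hx.1 hv).ne'
  exact (Real.rpow_left_inj hx.1.le hv.le (sub_ne_zero.2 hγ')).1 (sub_eq_zero.1 h1)
end
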